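/- As y → 0, J_BS(e^y) = (3/2)y² − (3/10)y³ + (109/1400)y⁴ + O(y⁵); that is, the function y ↦ (J_BS(e^y) − (3/2)y² + (3/10)y³ − (109/1400)y⁴)/y⁵ is bounded in a punctured neighborhood of y = 0. -/

import Mathlib

/-- `sinh β / β`, extended by its limiting value `1` at `β = 0`. -/
noncomputable def sinhc (b : ℝ) : ℝ := if b = 0 then 1 else Real.sinh b / b

/-- `sin (2ξ) / (2ξ)`, extended by its limiting value `1` at `ξ = 0`. -/
noncomputable def sinc2 (x : ℝ) : ℝ := if x = 0 then 1 else Real.sin (2 * x) / (2 * x)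

/-- `J` is the Black–Scholes Asian rate function `J_BS`: for `k ≥ 1`,
`J k = β²/2 − β·tanh(β/2)` where `β ≥ 0` solves `sinh β/β = k`, and for `0 < k ≤ 1`,
`J k = 2ξ(tan ξ − ξ)` where `ξ ∈ [0, π/2]` solves `sin(2ξ)/(2ξ) = k`. -/
def IsJBS (J : ℝ → ℝ) : Prop :=
  (∀ k : ℝ, 1 ≤ k → ∀ β : ℝ, 0 ≤ β → sinhc β = k →
      J k = β ^ 2 / 2 - β * Real.tanh (β / 2)) ∧
  (∀ k : ℝ, 0 < k → k ≤ 1 → ∀ ξ : ℝ, ξ ∈ Set.Icc 0 (Real.pi / 2) → sinc2 ξ = k →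
      J k = 2 * ξ * (Real.tan ξ - ξ))

section TaylorRemainders

open Asymptotics Filter Topology

theorem Complex.norm_sinh_sub_le {z : ℂ} (hz : ‖z‖ ≤ 1) :
    ‖Complex.sinh z - z * (1 + z ^ 2 / 6 + z ^ 4 / 120 + z ^ 6 / 5040)‖ ≤ ‖z‖ ^ 9 := by
  have h₁ := Complex.exp_bound hz (n := 9) (by norm_num)
  have h₂ := Complex.exp_bound (x := -z) (by simpa using hz) (n := 9) (by norm_num)
  rw [norm_neg] at h₂
  have hc : ((Nat.succ 9 : ℕ) * ((Nat.factorial 9 : ℕ) * (9 : ℕ) : ℝ)⁻¹ : ℝ) ≤ 1 := by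
    norm_num [Nat.factorial]
  have hz9 : ‖z‖ ^ 9 * ((Nat.succ 9 : ℕ) * ((Nat.factorial 9 : ℕ) * (9 : ℕ) : ℝ)⁻¹ : ℝ)
      ≤ ‖z‖ ^ 9 := mul_le_of_le_one_right (by positivity) hc
  have key : Complex.sinh z - z * (1 + z ^ 2 / 6 + z ^ 4 / 120 + z ^ 6 / 5040) =
      ((Complex.exp z - ∑ m ∈ Finset.range 9, z ^ m / m.factorial) -
        (Complex.exp (-z) - ∑ m ∈ Finset.range 9, (-z) ^ m / m.factorial)) / 2 := by
    simp only [Complex.sinh, Finset.sum_range_succ, Finset.sum_range_zero, Nat.factorial]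
    push_cast
    ring
  rw [key, norm_div, Complex.norm_ofNat]
  linarith [norm_sub_le (Complex.exp z - ∑ m ∈ Finset.range 9, z ^ m / m.factorial)
    (Complex.exp (-z) - ∑ m ∈ Finset.range 9, (-z) ^ m / m.factorial)]

theorem Complex.norm_cosh_sub_le {z : ℂ} (hz : ‖z‖ ≤ 1) :
    ‖Complex.cosh z - (1 + z ^ 2 / 2 + z ^ 4 / 24 + z ^ 6 / 720)‖ ≤ ‖z‖ ^ 8 := by
  have h₁ := Complex.exp_bound hz (n := 8) (by norm_num)
  have h₂ := Complex.exp_bound (x := -z) (by simpa using hz) (n := 8) (by norm_num)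
  rw [norm_neg] at h₂
  have hc : ((Nat.succ 8 : ℕ) * ((Nat.factorial 8 : ℕ) * (8 : ℕ) : ℝ)⁻¹ : ℝ) ≤ 1 := by
    norm_num [Nat.factorial]
  have hz8 : ‖z‖ ^ 8 * ((Nat.succ 8 : ℕ) * ((Nat.factorial 8 : ℕ) * (8 : ℕ) : ℝ)⁻¹ : ℝ)
      ≤ ‖z‖ ^ 8 := mul_le_of_le_one_right (by positivity) hc
  have key : Complex.cosh z - (1 + z ^ 2 / 2 + z ^ 4 / 24 + z ^ 6 / 720) =
      ((Complex.exp z - ∑ m ∈ Finset.range 8, z ^ m / m.factorial) +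
        (Complex.exp (-z) - ∑ m ∈ Finset.range 8, (-z) ^ m / m.factorial)) / 2 := by
    simp only [Complex.cosh, Finset.sum_range_succ, Finset.sum_range_zero, Nat.factorial]
    push_cast
    ring
  rw [key, norm_div, Complex.norm_ofNat]
  linarith [norm_add_le (Complex.exp z - ∑ m ∈ Finset.range 8, z ^ m / m.factorial)
    (Complex.exp (-z) - ∑ m ∈ Finset.range 8, (-z) ^ m / m.factorial)]

theorem Real.log_one_add_sub_isBigO :
    (fun x : ℝ => Real.log (1 + x) - (x - x ^ 2 / 2 + x ^ 3 / 3)) =O[𝓝 0] fun x => x ^ 4 := by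
  refine IsBigO.of_bound 2 ?_
  filter_upwards [Metric.ball_mem_nhds (0 : ℝ) (ε := 1 / 2) (by norm_num)] with x hx
  have hx' : |x| < 1 / 2 := by simpa using hx
  have h := Real.abs_log_sub_add_sum_range_le (x := -x) (by rw [abs_neg]; linarith) 3
  rw [abs_neg] at h
  simp only [Real.norm_eq_abs, abs_pow]
  calc |Real.log (1 + x) - (x - x ^ 2 / 2 + x ^ 3 / 3)|
      = |(∑ i ∈ Finset.range 3, (-x) ^ (i + 1) / ((i : ℝ) + 1)) + Real.log (1 - -x)| := by
        congr 1
        simp only [Finset.sum_range_succ, Finset.sum_range_zero, sub_neg_eq_add]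
        push_cast
        ring
    _ ≤ |x| ^ (3 + 1) / (1 - |x|) := h
    _ ≤ 2 * |x| ^ 4 := by
        rw [div_le_iff₀ (by linarith)]
        have : 0 ≤ |x| ^ 4 := by positivity
        norm_num
        nlinarith

theorem ContinuousAt.isBigO_pow_mul {g : ℝ → ℝ} (hg : ContinuousAt g 0) (n : ℕ) :
    (fun u => u ^ n * g u) =O[𝓝 0] fun u => u ^ n := by
  simpa using (isBigO_refl (fun u : ℝ => u ^ n) (𝓝 0)).mul (hg.tendsto.isBigO_one ℝ)

theorem Asymptotics.IsBigO.mul_tendsto {f g h : ℝ → ℝ} {c : ℝ} (hf : f =O[𝓝 0] h)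
    (hg : Tendsto g (𝓝 0) (𝓝 c)) : (fun u => f u * g u) =O[𝓝 0] h := by
  simpa using hf.mul (hg.isBigO_one ℝ)

end TaylorRemainders

section Parametrization

open Asymptotics Filter Topology

/-- The entire function `sinh √u / √u` on the real line. -/
noncomputable def sinhcSqrt (u : ℝ) : ℝ :=
  if 0 ≤ u then sinhc (Real.sqrt u) else sinc2 (Real.sqrt (-u) / 2)

/-- The entire function `cosh √u` on the real line. -/
noncomputable def coshSqrt (u : ℝ) : ℝ :=
  if 0 ≤ u then Real.cosh (Real.sqrt u) else Real.cos (Real.sqrt (-u))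

theorem mul_sinhc (b : ℝ) : b * sinhc b = Real.sinh b := by
  unfold sinhc
  split_ifs with h
  · simp [h]
  · field_simp

theorem mul_sinc2_half (w : ℝ) : w * sinc2 (w / 2) = Real.sin w := by
  unfold sinc2
  split_ifs with h
  · have : w = 0 := by linarith
    simp [this]
  · have : w ≠ 0 := fun hw => h (by simp [hw])
    rw [mul_div_cancel₀ w two_ne_zero]
    field_simp

theorem exists_sinh_cosh_eq (u : ℝ) : ∃ z : ℂ, z ^ 2 = u ∧
    Complex.sinh z = z * sinhcSqrt u ∧ Complex.cosh z = coshSqrt u := by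
  by_cases hu : 0 ≤ u
  · refine ⟨(Real.sqrt u : ℝ), ?_, ?_, ?_⟩
    · rw [← Complex.ofReal_pow, Real.sq_sqrt hu]
    · rw [sinhcSqrt, if_pos hu, ← Complex.ofReal_mul, mul_sinhc, Complex.ofReal_sinh]
    · rw [coshSqrt, if_pos hu, Complex.ofReal_cosh]
  · refine ⟨(Real.sqrt (-u) : ℝ) * Complex.I, ?_, ?_, ?_⟩
    · rw [mul_pow, ← Complex.ofReal_pow, Real.sq_sqrt (by linarith)]
      simp
    · rw [sinhcSqrt, if_neg hu, mul_right_comm, ← Complex.ofReal_mul, mul_sinc2_half,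
        Complex.sinh_mul_I, Complex.ofReal_sin]
    · rw [coshSqrt, if_neg hu, Complex.cosh_mul_I, Complex.ofReal_cos]

theorem sinhcSqrt_zero : sinhcSqrt 0 = 1 := by simp [sinhcSqrt, sinhc]

theorem sinhcSqrt_sub_isBigO :
    (fun u => sinhcSqrt u - (1 + u / 6 + u ^ 2 / 120 + u ^ 3 / 5040)) =O[𝓝 0]
      fun u => u ^ 4 := by
  refine IsBigO.of_bound 1 ?_
  filter_upwards [Metric.closedBall_mem_nhds (0 : ℝ) one_pos] with u hu
  have hu1 : |u| ≤ 1 := by simpa using hu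
  rcases eq_or_ne u 0 with rfl | hu0
  · simp [sinhcSqrt_zero]
  obtain ⟨z, hz, hs, -⟩ := exists_sinh_cosh_eq u
  have hn : ‖z‖ ^ 2 = |u| := by rw [← norm_pow, hz, Complex.norm_real, Real.norm_eq_abs]
  have hz0 : 0 < ‖z‖ := by
    refine norm_pos_iff.2 fun h => hu0 ?_
    rw [h] at hz
    exact_mod_cast (by simpa using hz.symm : (u : ℂ) = 0)
  have hz1 : ‖z‖ ≤ 1 := by nlinarith
  have h := Complex.norm_sinh_sub_le hz1
  have key : Complex.sinh z - z * (1 + z ^ 2 / 6 + z ^ 4 / 120 + z ^ 6 / 5040) =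
      z * ((sinhcSqrt u - (1 + u / 6 + u ^ 2 / 120 + u ^ 3 / 5040) : ℝ) : ℂ) := by
    push_cast
    rw [hs, ← hz]
    ring
  rw [key, norm_mul, Complex.norm_real, pow_succ' _ 8] at h
  have h8 := le_of_mul_le_mul_left h hz0
  rw [one_mul, norm_pow, Real.norm_eq_abs u, ← hn, ← pow_mul]
  exact h8

theorem coshSqrt_sub_isBigO :
    (fun u => coshSqrt u - (1 + u / 2 + u ^ 2 / 24 + u ^ 3 / 720)) =O[𝓝 0]
      fun u => u ^ 4 := by
  refine IsBigO.of_bound 1 ?_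
  filter_upwards [Metric.closedBall_mem_nhds (0 : ℝ) one_pos] with u hu
  have hu1 : |u| ≤ 1 := by simpa using hu
  obtain ⟨z, hz, -, hc⟩ := exists_sinh_cosh_eq u
  have hn : ‖z‖ ^ 2 = |u| := by rw [← norm_pow, hz, Complex.norm_real, Real.norm_eq_abs]
  have hz1 : ‖z‖ ≤ 1 := by nlinarith [norm_nonneg z]
  have h := Complex.norm_cosh_sub_le hz1
  have key : Complex.cosh z - (1 + z ^ 2 / 2 + z ^ 4 / 24 + z ^ 6 / 720) =
      ((coshSqrt u - (1 + u / 2 + u ^ 2 / 24 + u ^ 3 / 720) : ℝ) : ℂ) := by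
    push_cast
    rw [hc, ← hz]
    ring
  rw [key, Complex.norm_real] at h
  rw [one_mul, norm_pow, Real.norm_eq_abs u, ← hn, ← pow_mul]
  exact h

theorem continuous_sinhc : Continuous sinhc := by
  have h : sinhc = dslope Real.sinh 0 := by
    ext b
    rcases eq_or_ne b 0 with rfl | hb
    · simp [sinhc, dslope_same]
    · simp [sinhc, hb, dslope_of_ne, slope, div_eq_inv_mul]
  rw [h, ← continuousOn_univ, continuousOn_dslope univ_mem]
  exact ⟨Real.continuous_sinh.continuousOn, Real.differentiable_sinh 0⟩

theorem continuous_sinc2 : Continuous sinc2 := by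
  have h : sinc2 = fun x => Real.sinc (2 * x) := by
    ext x
    simp [sinc2, Real.sinc_apply]
  rw [h]
  exact Real.continuous_sinc.comp (by fun_prop)

theorem continuous_sinhcSqrt : Continuous sinhcSqrt := by
  refine Continuous.if_le (continuous_sinhc.comp Real.continuous_sqrt)
    (continuous_sinc2.comp (by fun_prop)) continuous_const continuous_id ?_
  rintro _ rfl
  simp [sinhc, sinc2]

theorem tendsto_sinhcSqrt : Tendsto sinhcSqrt (𝓝 0) (𝓝 1) := by
  simpa [sinhcSqrt_zero] using continuous_sinhcSqrt.tendsto 0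

theorem tendsto_coshSqrt : Tendsto coshSqrt (𝓝 0) (𝓝 1) := by
  have h := coshSqrt_sub_isBigO.trans_tendsto
    ((continuous_pow 4).tendsto' (0 : ℝ) 0 (by simp))
  simpa using h.add ((by fun_prop : Continuous fun u : ℝ =>
    1 + u / 2 + u ^ 2 / 24 + u ^ 3 / 720).tendsto' 0 1 (by simp))


theorem one_lt_sinhcSqrt {u : ℝ} (hu : 0 < u) : 1 < sinhcSqrt u := by
  have h := Real.sqrt_pos.2 hu
  rw [sinhcSqrt, if_pos hu.le, sinhc, if_neg h.ne', one_lt_div h]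
  exact Real.self_lt_sinh_iff.2 h

theorem sinhcSqrt_lt_one {u : ℝ} (hu : u < 0) : sinhcSqrt u < 1 := by
  have h : 0 < Real.sqrt (-u) := Real.sqrt_pos.2 (by linarith)
  rw [sinhcSqrt, if_neg hu.not_ge, sinc2, if_neg (by positivity), mul_div_cancel₀ _ two_ne_zero,
    div_lt_one h]
  exact Real.sin_lt h

/-- The rate function in terms of `u`, where `u = β²` on the branch `k ≥ 1` and `u = -4ξ²` on
the branch `k ≤ 1`. -/
theorem IsJBS.apply_sinhcSqrt {J : ℝ → ℝ} (hJ : IsJBS J) {u : ℝ} (hu : |u| ≤ 1)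
    (hpos : 0 < sinhcSqrt u) :
    J (sinhcSqrt u) = u / 2 - u * sinhcSqrt u / (coshSqrt u + 1) := by
  rcases le_or_gt 0 u with h0 | h0
  · have hk : 1 ≤ sinhcSqrt u := by
      rcases h0.eq_or_lt with rfl | h0
      · exact sinhcSqrt_zero.ge
      · exact (one_lt_sinhcSqrt h0).le
    have hS : sinhcSqrt u = sinhc (Real.sqrt u) := if_pos h0
    rw [hJ.1 _ hk (Real.sqrt u) (Real.sqrt_nonneg u) hS.symm, hS, coshSqrt, if_pos h0]
    set b := Real.sqrt u
    have hb : b ^ 2 = u := Real.sq_sqrt h0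
    have hus : u * sinhc b = b * Real.sinh b := by rw [← hb, ← mul_sinhc]; ring
    have hc : Real.cosh (b / 2) ≠ 0 := (Real.cosh_pos _).ne'
    have hsinh : Real.sinh b = 2 * Real.sinh (b / 2) * Real.cosh (b / 2) := by
      rw [← Real.sinh_two_mul]; congr 1; ring
    have hcosh : Real.cosh b + 1 = 2 * Real.cosh (b / 2) ^ 2 := by
      have h2 := Real.cosh_two_mul (b / 2)
      rw [mul_div_cancel₀ b two_ne_zero] at h2
      linarith [Real.cosh_sq (b / 2)]
    rw [hus, hcosh, hsinh, hb, Real.tanh_eq_sinh_div_cosh]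
    field_simp
  · have hS : sinhcSqrt u = sinc2 (Real.sqrt (-u) / 2) := if_neg h0.not_ge
    have hw1 : Real.sqrt (-u) ≤ 1 := Real.sqrt_le_one.2 (by linarith [(abs_le.1 hu).1])
    have hw0 := Real.sqrt_nonneg (-u)
    have hmem : Real.sqrt (-u) / 2 ∈ Set.Icc 0 (Real.pi / 2) :=
      ⟨by positivity, by linarith [Real.pi_gt_three]⟩
    rw [hJ.2 _ hpos (sinhcSqrt_lt_one h0).le _ hmem hS.symm, hS, coshSqrt, if_neg h0.not_ge]
    set w := Real.sqrt (-u)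
    have hw : w ^ 2 = -u := Real.sq_sqrt (by linarith)
    have hus : u * sinc2 (w / 2) = -(w * Real.sin w) := by
      rw [← mul_sinc2_half]; linear_combination sinc2 (w / 2) * hw
    have hc : Real.cos (w / 2) ≠ 0 := by
      refine (Real.cos_pos_of_mem_Ioo ⟨?_, ?_⟩).ne' <;> linarith [Real.pi_gt_three]
    have hsin : Real.sin w = 2 * Real.sin (w / 2) * Real.cos (w / 2) := by
      rw [← Real.sin_two_mul]; congr 1; ring
    have hcos : Real.cos w + 1 = 2 * Real.cos (w / 2) ^ 2 := by
      have h2 := Real.cos_two_mul (w / 2)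
      rw [mul_div_cancel₀ w two_ne_zero] at h2
      linarith
    rw [hus, hcos, hsin, Real.tan_eq_sin_div_cos]
    field_simp
    linear_combination -Real.cos (w / 2) * hw

end Parametrization

section Expansion

open Asymptotics Filter Topology

theorem log_sinhcSqrt_sub_isBigO :
    (fun u => Real.log (sinhcSqrt u) - (u / 6 - u ^ 2 / 180 + u ^ 3 / 2835)) =O[𝓝 0]
      fun u => u ^ 4 := by
  have hx0 : Tendsto (fun u => sinhcSqrt u - 1) (𝓝 0) (𝓝 0) := by
    simpa using tendsto_sinhcSqrt.sub_const 1
  have hp0 : Tendsto (fun u : ℝ => u / 6 + u ^ 2 / 120 + u ^ 3 / 5040) (𝓝 0) (𝓝 0) :=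
    (by fun_prop : Continuous _).tendsto' _ _ (by simp)
  have hx : (fun u => sinhcSqrt u - 1) =O[𝓝 0] fun u => u := by
    have h₁ : (fun u : ℝ => u ^ 4) =O[𝓝 0] fun u => u :=
      (isLittleO_pow_id (by norm_num)).isBigO
    have h₂ := ContinuousAt.isBigO_pow_mul
      (g := fun u => 1 / 6 + u / 120 + u ^ 2 / 5040) (by fun_prop) 1
    simp only [pow_one] at h₂
    refine ((sinhcSqrt_sub_isBigO.trans h₁).add h₂).congr_left fun u => ?_
    ring
  have h₁ := (Real.log_one_add_sub_isBigO.comp_tendsto hx0).trans (hx.pow 4)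
  have h₂ := sinhcSqrt_sub_isBigO.mul_tendsto
    ((((hx0.add hp0).div_const 2).const_sub 1).add
      ((((hx0.pow 2).add (hx0.mul hp0)).add (hp0.pow 2)).div_const 3))
  have h₃ := ContinuousAt.isBigO_pow_mul (g := fun u => 11 / 67200 + u / 64800
    + 23 / 31752000 * u ^ 2 + 31 / 1524096000 * u ^ 3 + u ^ 4 / 3048192000
    + u ^ 5 / 384072192000) (by fun_prop) 4
  refine ((h₁.add h₂).add h₃).congr_left fun u => ?_
  simp only [Function.comp_apply, add_sub_cancel]
  ring

theorem tendsto_log_sinhcSqrt : Tendsto (fun u => Real.log (sinhcSqrt u)) (𝓝 0) (𝓝 0) := by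
  simpa using tendsto_sinhcSqrt.log one_ne_zero

theorem log_sinhcSqrt_isEquivalent :
    (fun u => Real.log (sinhcSqrt u)) ~[𝓝 0] fun u => u / 6 := by
  have h₁ : (fun u : ℝ => u ^ 4) =O[𝓝 0] fun u => u ^ 2 := by
    refine (ContinuousAt.isBigO_pow_mul (g := fun u => u ^ 2) (by fun_prop) 2).congr_left
      fun u => ?_
    ring
  have h₂ := ContinuousAt.isBigO_pow_mul
    (g := fun u => -1 / 180 + u / 2835) (by fun_prop) 2
  have h₃ : (fun u : ℝ => u ^ 2) =o[𝓝 0] fun u => u / 6 := by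
    have := (isLittleO_pow_id (𝕜 := ℝ) one_lt_two).const_mul_right (c := 1 / 6) (by norm_num)
    simpa [div_eq_inv_mul] using this
  refine (((log_sinhcSqrt_sub_isBigO.trans h₁).add h₂).trans_isLittleO h₃).congr_left fun u => ?_
  simp only [Pi.sub_apply]
  ring

theorem rate_sub_isBigO :
    (fun u => u / 2 - u * sinhcSqrt u / (coshSqrt u + 1)
      - (u ^ 2 / 24 - u ^ 3 / 240 + 17 / 40320 * u ^ 4)) =O[𝓝 0] fun u => u ^ 5 := by
  have hC : Tendsto (fun u => coshSqrt u + 1) (𝓝 0) (𝓝 2) := by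
    have := tendsto_coshSqrt.add_const 1
    norm_num at this
    exact this
  have h5 : ∀ {f : ℝ → ℝ}, (f =O[𝓝 0] fun u => u ^ 4) →
      (fun u => u * f u) =O[𝓝 0] fun u => u ^ 5 := fun hf =>
    ((isBigO_refl (fun u : ℝ => u) (𝓝 0)).mul hf).congr_right fun u => by ring
  have h₁ := (h5 coshSqrt_sub_isBigO).mul_tendsto (c := 1 / 2)
    (g := fun u => 1 / 2 - (u / 24 - u ^ 2 / 240 + 17 / 40320 * u ^ 3))
    ((by fun_prop : Continuous _).tendsto' _ _ (by simp))
  have h₂ := h5 sinhcSqrt_sub_isBigO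
  have h₃ := ContinuousAt.isBigO_pow_mul
    (g := fun u => -23 / 241920 - 19 / 1612800 * u - 17 / 29030400 * u ^ 2) (by fun_prop) 5
  refine (((h₁.sub h₂).add h₃).mul_tendsto (hC.inv₀ two_ne_zero)).congr' ?_ EventuallyEq.rfl
  filter_upwards [hC.eventually_ne two_ne_zero] with u hu
  field_simp
  ring

theorem quartic_log_sinhcSqrt_sub_isBigO :
    (fun u => 3 / 2 * Real.log (sinhcSqrt u) ^ 2 - 3 / 10 * Real.log (sinhcSqrt u) ^ 3
        + 109 / 1400 * Real.log (sinhcSqrt u) ^ 4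
      - (u ^ 2 / 24 - u ^ 3 / 240 + 17 / 40320 * u ^ 4)) =O[𝓝 0] fun u => u ^ 5 := by
  have hL0 := tendsto_log_sinhcSqrt
  have hm0 : Tendsto (fun u : ℝ => u / 6 - u ^ 2 / 180 + u ^ 3 / 2835) (𝓝 0) (𝓝 0) :=
    (by fun_prop : Continuous _).tendsto' _ _ (by simp)
  have hL : (fun u => Real.log (sinhcSqrt u)) =O[𝓝 0] fun u => u :=
    log_sinhcSqrt_isEquivalent.isBigO.trans <| by
      simpa [div_eq_inv_mul] using (isBigO_refl (fun u : ℝ => u) (𝓝 0)).const_mul_left (1 / 6)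
  have hm : (fun u : ℝ => u / 6 - u ^ 2 / 180 + u ^ 3 / 2835) =O[𝓝 0] fun u => u := by
    have h := ContinuousAt.isBigO_pow_mul
      (g := fun u => 1 / 6 - u / 180 + u ^ 2 / 2835) (by fun_prop) 1
    simp only [pow_one] at h
    exact h.congr_left fun u => by ring
  have hfac := (hL.add hm).mul_tendsto (c := 3 / 2)
    (g := fun u => 3 / 2 - 3 / 10 * (Real.log (sinhcSqrt u))
      + 109 / 1400 * (Real.log (sinhcSqrt u) ^ 2 + (u / 6 - u ^ 2 / 180 + u ^ 3 / 2835) ^ 2))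
    (by simpa using ((hL0.const_mul (3 / 10)).const_sub (3 / 2)).add
          (((hL0.pow 2).add (hm0.pow 2)).const_mul (109 / 1400)))
  have hfac' := hm.mul_tendsto (hm0.const_mul (3 / 10))
  have h₁ := (log_sinhcSqrt_sub_isBigO.mul (hfac.sub hfac')).congr_right
    (g₂ := fun u => u ^ 5) fun u => by ring
  have h₂ := ContinuousAt.isBigO_pow_mul (g := fun u => -31 / 1134000
    + 29749 / 17146080000 * u - 2521 / 28576800000 * u ^ 2 + 865463 / 216040608000000 * u ^ 3
    - 16969 / 121522842000000 * u ^ 4 + 15587 / 3827969523000000 * u ^ 5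
    - 109 / 1435488571125000 * u ^ 6 + 109 / 90435779980875000 * u ^ 7) (by fun_prop) 5
  refine (h₁.add h₂).congr_left fun u => ?_
  ring

theorem rate_sub_quartic_log_isBigO :
    (fun u => u / 2 - u * sinhcSqrt u / (coshSqrt u + 1) - (3 / 2) * Real.log (sinhcSqrt u) ^ 2
        + (3 / 10) * Real.log (sinhcSqrt u) ^ 3 - (109 / 1400) * Real.log (sinhcSqrt u) ^ 4)
      =O[𝓝 0] fun u => Real.log (sinhcSqrt u) ^ 5 := by
  have hu : (fun u : ℝ => u) =O[𝓝 0] fun u => Real.log (sinhcSqrt u) := by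
    refine (IsBigO.of_bound 6 (Eventually.of_forall fun u => ?_)).trans
      log_sinhcSqrt_isEquivalent.isBigO_symm
    rw [norm_div, Real.norm_ofNat]
    linarith
  refine ((rate_sub_isBigO.sub quartic_log_sinhcSqrt_sub_isBigO).congr_left fun u => ?_).trans
    (hu.pow 5)
  ring

end Expansion

/-- Small-`y` expansion `J_BS(e^y) = (3/2)y² − (3/10)y³ + (109/1400)y⁴ + O(y⁵)`. -/
theorem jbs_exp_taylor (J : ℝ → ℝ) (hJ : IsJBS J) :
    ∃ C > (0:ℝ), ∃ δ > (0:ℝ), ∀ y : ℝ, y ≠ 0 → |y| < δ →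
      |J (Real.exp y) - (3/2) * y ^ 2 + (3/10) * y ^ 3 - (109/1400) * y ^ 4|
        ≤ C * |y| ^ 5 := by
  obtain ⟨C, hC, hbound⟩ := rate_sub_quartic_log_isBigO.exists_pos
  obtain ⟨ε, hε, hball⟩ := Metric.eventually_nhds_iff.1 hbound.bound
  set e := min (ε / 2) 1
  have he : 0 < e := by positivity
  have hIoo : Set.Ioo (sinhcSqrt (-e)) (sinhcSqrt e) ∈ nhds (Real.exp 0) := by
    rw [Real.exp_zero]
    exact Ioo_mem_nhds (sinhcSqrt_lt_one (by linarith)) (one_lt_sinhcSqrt he)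
  obtain ⟨δ, hδ, hexp⟩ :=
    Metric.eventually_nhds_iff.1 (Real.continuous_exp.continuousAt.eventually hIoo)
  refine ⟨C, hC, δ, hδ, fun y _ hy => ?_⟩
  obtain ⟨u, hu, huy⟩ := intermediate_value_Icc (by linarith : -e ≤ e)
    continuous_sinhcSqrt.continuousOn
    (Set.Ioo_subset_Icc_self (hexp (by simpa using hy : dist y 0 < δ)))
  have hue : |u| ≤ e := abs_le.2 hu
  have hb := hball (y := u) (by
    rw [Real.dist_0_eq_abs]
    linarith [min_le_left (ε / 2) 1])
  have hJu := hJ.apply_sinhcSqrt (hue.trans (min_le_right _ _)) (huy ▸ Real.exp_pos y)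
  rw [← hJu, huy, Real.log_exp, norm_pow, Real.norm_eq_abs, Real.norm_eq_abs] at hb
  exact hb
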